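/- (Eigenvalue bound) Let n ≥ 2 and λ ∈ 𝒫ₙ, and set θ_λ⁽ⁿ⁾ = (1/(n(n−1))) Σ_{j≥1} λⱼ(λⱼ − 2j + 1). Then θ_λ⁽ⁿ⁾ = (Σᵢ λᵢ² − Σⱼ (λ'ⱼ)²)/(n(n−1)), where λ' is the conjugate (transposed) partition, and |θ_λ⁽ⁿ⁾| ≤ max(λ₁, N_λ)/n. Consequently, for η ∈ (0,1) there is n₂ = n₂(η) such that for all n ≥ n₂ and all λ ∈ 𝒫ₙ with λ₁ ≤ n − 2n^η and N_λ ≤ n − 2n^η, one has |θ_λ⁽ⁿ⁾| ≤ exp(−n^{η−1}). -/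

import Mathlib

open MeasureTheory ENNReal Filter Set

noncomputable section

/-- The set `𝒫ₙ` of integer partitions of `n`, as nonincreasing sequences. -/
def PartN (n : ℕ) : Set (ℕ → ℕ) :=
  {l | Antitone l ∧ ∑' i, (l i : ℝ≥0∞) = n}

/-- `N_λ`, the total number of nonzero parts of `λ`. -/
def numParts (l : ℕ → ℕ) : ℕ := Nat.card {i | l i ≠ 0}

/-- The conjugate (transposed) partition: `λ'ⱼ = #{i : λᵢ ≥ j}` (here with
`0`-based index, `conjPart l j = λ'_{j+1}`). -/
def conjPart (l : ℕ → ℕ) (j : ℕ) : ℕ := Nat.card {i | j + 1 ≤ l i}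

/-- The eigenvalue `θ_λ⁽ⁿ⁾ = (1/(n(n-1))) Σ_{j≥1} λⱼ(λⱼ - 2j + 1)` of the
DCF⁽ⁿ⁾ kernel associated with the character `χ_λ` (`0`-based index `i = j-1`). -/
def thetaEig (n : ℕ) (l : ℕ → ℕ) : ℝ :=
  (∑' i : ℕ, (l i : ℝ) * ((l i : ℝ) - 2 * ((i : ℝ) + 1) + 1)) /
    ((n : ℝ) * ((n : ℝ) - 1))

theorem PartN.sum_range {n : ℕ} {l : ℕ → ℕ} (h : l ∈ PartN n) (k : ℕ) :
    ∑ i ∈ Finset.range k, l i ≤ n := by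
  have := ENNReal.sum_le_tsum (f := fun i => (l i : ℝ≥0∞)) (Finset.range k)
  rw [h.2] at this
  exact_mod_cast this

theorem PartN.eq_zero_of_le {n : ℕ} {l : ℕ → ℕ} (h : l ∈ PartN n) {i : ℕ} (hi : n ≤ i) :
    l i = 0 := by
  by_contra h0
  have h1 : ∑ _k ∈ Finset.range (i + 1), 1 ≤ ∑ k ∈ Finset.range (i + 1), l k :=
    Finset.sum_le_sum fun k hk => by
      have := h.1 (Nat.lt_succ_iff.mp (Finset.mem_range.mp hk))
      omega
  have h2 := PartN.sum_range h (i + 1)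
  simp at h1
  omega

theorem PartN.sum_eq {n : ℕ} {l : ℕ → ℕ} (h : l ∈ PartN n) :
    ∑ i ∈ Finset.range n, l i = n := by
  have h2 := h.2
  rw [tsum_eq_sum (s := Finset.range n) fun i hi => by
    simp [PartN.eq_zero_of_le h (by simpa using hi)]] at h2
  exact_mod_cast h2

theorem PartN.le {n : ℕ} {l : ℕ → ℕ} (h : l ∈ PartN n) (i : ℕ) : l i ≤ n := by
  have h0 := PartN.sum_range h 1
  have := h.1 (Nat.zero_le i)
  simp at h0
  omega

/-- Membership in the Young diagram, read by rows or by columns. -/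
theorem PartN.lt_conjPart_iff {n : ℕ} {l : ℕ → ℕ} (h : l ∈ PartN n) (i j : ℕ) :
    i < conjPart l j ↔ j < l i := by
  classical
  have hex : ∃ i, l i ≤ j := ⟨n, by simp [PartN.eq_zero_of_le h le_rfl]⟩
  have hiff : ∀ i, j + 1 ≤ l i ↔ i < Nat.find hex := fun i => by
    rw [Nat.lt_find_iff]
    refine ⟨fun hi m hm => ?_, fun hi => ?_⟩
    · have := h.1 hm
      omega
    · have := hi i le_rfl
      omega
  have hc : conjPart l j = Nat.find hex := by
    have : {i | j + 1 ≤ l i} = Set.Iio (Nat.find hex) := Set.ext hiff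
    rw [conjPart, this]
    simp
  rw [hc, ← hiff, Nat.succ_le_iff]

theorem PartN.conjPart_le {n : ℕ} {l : ℕ → ℕ} (h : l ∈ PartN n) (j : ℕ) :
    conjPart l j ≤ n := by
  by_contra! hc
  have := (PartN.lt_conjPart_iff h n j).1 hc
  simp [PartN.eq_zero_of_le h le_rfl] at this

theorem PartN.conjPart_eq_zero_of_le {n : ℕ} {l : ℕ → ℕ} (h : l ∈ PartN n) {j : ℕ}
    (hj : n ≤ j) : conjPart l j = 0 := by
  by_contra hc
  have := (PartN.lt_conjPart_iff h 0 j).1 (Nat.pos_of_ne_zero hc)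
  have := PartN.le h 0
  omega

theorem conjPart_zero (l : ℕ → ℕ) : conjPart l 0 = numParts l := by
  simp only [conjPart, numParts, zero_add, Nat.one_le_iff_ne_zero]

theorem PartN.conjPart_le_numParts {n : ℕ} {l : ℕ → ℕ} (h : l ∈ PartN n) (j : ℕ) :
    conjPart l j ≤ numParts l := by
  rw [← conjPart_zero]
  by_contra! hc
  have h1 := (PartN.lt_conjPart_iff h _ j).1 hc
  have h2 := (PartN.lt_conjPart_iff h (conjPart l 0) 0).2 (by omega)
  omega

theorem PartN.sum_sum_conjPart {n : ℕ} {l : ℕ → ℕ} (h : l ∈ PartN n) (f : ℕ → ℕ) :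
    ∑ j ∈ Finset.range n, ∑ i ∈ Finset.range (conjPart l j), f i =
      ∑ i ∈ Finset.range n, l i * f i := by
  rw [Finset.sum_comm' (t' := Finset.range n) (s' := fun i => Finset.range (l i))]
  · simp
  · intro j i
    simp only [Finset.mem_range, PartN.lt_conjPart_iff h]
    refine ⟨fun ⟨_, hji⟩ => ⟨hji, ?_⟩, fun ⟨hji, _⟩ => ⟨hji.trans_le (PartN.le h i), hji⟩⟩
    by_contra! hi
    simp [PartN.eq_zero_of_le h hi] at hji

theorem PartN.sum_conjPart {n : ℕ} {l : ℕ → ℕ} (h : l ∈ PartN n) :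
    ∑ j ∈ Finset.range n, conjPart l j = n := by
  simpa [PartN.sum_eq h] using PartN.sum_sum_conjPart h fun _ => 1

theorem PartN.sum_conjPart_sq {n : ℕ} {l : ℕ → ℕ} (h : l ∈ PartN n) :
    ∑ j ∈ Finset.range n, conjPart l j ^ 2 = ∑ i ∈ Finset.range n, l i * (2 * i + 1) := by
  rw [← PartN.sum_sum_conjPart h]
  refine Finset.sum_congr rfl fun j _ => ?_
  induction conjPart l j with
  | zero => simp
  | succ m ih => rw [Finset.sum_range_succ, ← ih]; ring

theorem PartN.thetaEig_eq {n : ℕ} {l : ℕ → ℕ} (h : l ∈ PartN n) :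
    thetaEig n l =
      ((∑ i ∈ Finset.range n, (l i : ℝ) ^ 2) - ∑ j ∈ Finset.range n, (conjPart l j : ℝ) ^ 2) /
        ((n : ℝ) * ((n : ℝ) - 1)) := by
  have hsq : ∑ j ∈ Finset.range n, (conjPart l j : ℝ) ^ 2 =
      ∑ i ∈ Finset.range n, (l i : ℝ) * (2 * i + 1) := by
    exact_mod_cast PartN.sum_conjPart_sq h
  rw [thetaEig, tsum_eq_sum (s := Finset.range n) fun i hi => by
    simp [PartN.eq_zero_of_le h (by simpa using hi)], hsq, ← Finset.sum_sub_distrib]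
  congr 1
  exact Finset.sum_congr rfl fun i _ => by ring

theorem sum_sq_bounds {n M : ℕ} {a : ℕ → ℕ} (hsum : ∑ i ∈ Finset.range n, a i = n)
    (hM : ∀ i, a i ≤ M) :
    (n : ℝ) ≤ ∑ i ∈ Finset.range n, (a i : ℝ) ^ 2 ∧
      ∑ i ∈ Finset.range n, (a i : ℝ) ^ 2 ≤ M * n := by
  have h1 : ∑ i ∈ Finset.range n, a i ≤ ∑ i ∈ Finset.range n, a i ^ 2 :=
    Finset.sum_le_sum fun i _ => Nat.le_self_pow two_ne_zero _
  have h2 : ∑ i ∈ Finset.range n, a i ^ 2 ≤ ∑ i ∈ Finset.range n, M * a i :=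
    Finset.sum_le_sum fun i _ => by rw [sq]; exact Nat.mul_le_mul_right _ (hM i)
  rw [← Finset.mul_sum, hsum] at h2
  rw [hsum] at h1
  exact ⟨by exact_mod_cast h1, by exact_mod_cast h2⟩

theorem PartN.abs_thetaEig_le {n : ℕ} (hn : 2 ≤ n) {l : ℕ → ℕ} (h : l ∈ PartN n) :
    |thetaEig n l| ≤ (max (l 0) (numParts l) : ℝ) / n := by
  obtain ⟨ha, hb⟩ := sum_sq_bounds (PartN.sum_eq h) fun i => h.1 (Nat.zero_le i)
  obtain ⟨hc, hd⟩ := sum_sq_bounds (PartN.sum_conjPart h) (PartN.conjPart_le_numParts h)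
  have hn' : (2 : ℝ) ≤ n := by exact_mod_cast hn
  have hl : (l 0 : ℝ) ≤ n := by exact_mod_cast PartN.le h 0
  have hN : (numParts l : ℝ) ≤ n := by
    rw [← conjPart_zero]
    exact_mod_cast PartN.conjPart_le h 0
  rw [PartN.thetaEig_eq h]
  set M : ℝ := max (l 0) (numParts l)
  have hlM : (l 0 : ℝ) ≤ M := le_max_left _ _
  have hNM : (numParts l : ℝ) ≤ M := le_max_right _ _
  have hMn : M ≤ n := max_le hl hN
  have hpos : (0 : ℝ) < n * (n - 1) := by nlinarith
  have hnum : |(∑ i ∈ Finset.range n, (l i : ℝ) ^ 2) -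
      ∑ j ∈ Finset.range n, (conjPart l j : ℝ) ^ 2| ≤ (M - 1) * n := by
    rw [abs_le]
    constructor <;> nlinarith
  rw [abs_div, abs_of_pos hpos, div_le_div_iff₀ hpos (by linarith)]
  calc _ ≤ (M - 1) * n * n := by gcongr
    _ ≤ M * (n * (n - 1)) := by nlinarith

/-- **Lemma 4.3** (eigenvalue bound): for `n ≥ 2` and `λ ∈ 𝒫ₙ`,
`θ_λ⁽ⁿ⁾ = (Σᵢ λᵢ² − Σⱼ (λ'ⱼ)²)/(n(n−1))` and `|θ_λ⁽ⁿ⁾| ≤ max(λ₁, N_λ)/n`;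
consequently, for `η ∈ (0,1)` there is `n₂` such that for all `n ≥ n₂` and all
`λ ∈ 𝒫ₙ` with `λ₁ ≤ n − 2n^η` and `N_λ ≤ n − 2n^η`,
`|θ_λ⁽ⁿ⁾| ≤ exp(−n^{η−1})`. -/
theorem dcf_eigenvalue_bound :
    (∀ n : ℕ, 2 ≤ n → ∀ l ∈ PartN n,
      thetaEig n l =
        ((∑' i : ℕ, ((l i : ℝ)) ^ 2) - ∑' j : ℕ, ((conjPart l j : ℝ)) ^ 2) /
          ((n : ℝ) * ((n : ℝ) - 1)) ∧
      |thetaEig n l| ≤ (max (l 0) (numParts l) : ℝ) / n) ∧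
    (∀ η : ℝ, 0 < η → η < 1 → ∃ n₂ : ℕ, ∀ n : ℕ, n₂ ≤ n → ∀ l ∈ PartN n,
      (l 0 : ℝ) ≤ (n : ℝ) - 2 * (n : ℝ) ^ η →
      (numParts l : ℝ) ≤ (n : ℝ) - 2 * (n : ℝ) ^ η →
      |thetaEig n l| ≤ Real.exp (-(n : ℝ) ^ (η - 1))) := by
  refine ⟨fun n hn l h => ⟨?_, PartN.abs_thetaEig_le hn h⟩,
    fun η _ _ => ⟨2, fun n hn l h h0 hN => ?_⟩⟩
  · rw [PartN.thetaEig_eq h,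
      tsum_eq_sum (s := Finset.range n) fun i hi => by
        simp [PartN.eq_zero_of_le h (by simpa using hi)],
      tsum_eq_sum (s := Finset.range n) fun j hj => by
        simp [PartN.conjPart_eq_zero_of_le h (by simpa using hj)]]
  · have hn0 : (0 : ℝ) < n := by exact_mod_cast (by omega : 0 < n)
    have hpow : 0 ≤ (n : ℝ) ^ (η - 1) := Real.rpow_nonneg hn0.le _
    calc |thetaEig n l| ≤ (max (l 0) (numParts l) : ℝ) / n := PartN.abs_thetaEig_le hn h
      _ ≤ ((n : ℝ) - 2 * (n : ℝ) ^ η) / n := by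
        gcongr
        exact max_le h0 hN
      _ = 1 - 2 * (n : ℝ) ^ (η - 1) := by
        rw [Real.rpow_sub_one hn0.ne']
        field_simp
      _ ≤ -(n : ℝ) ^ (η - 1) + 1 := by linarith
      _ ≤ Real.exp (-(n : ℝ) ^ (η - 1)) := Real.add_one_le_exp _

end
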